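/- Let Ω ⊆ ℝⁿ be a bounded convex domain with uniformly oblique Lipschitz vector field β (constants a, η), φ ∈ C(∂Ω), and let u ∈ C(closure Ω) be a convex solution of det D²u = f (with λ ≤ f ≤ Λ) in Ω and D_β u = φ on ∂Ω in the viscosity sense. Then sup_Ω u − inf_Ω u ≤ C(a, η)·diam(Ω)·||φ||_{L^∞(∂Ω)}, and ||u||_{Lip(closure Ω)} ≤ C(a, η)·(1 + diam(Ω))·||φ||_{L^∞(∂Ω)}. -/

import Mathlib

open Metric Set MeasureTheory
open scoped RealInnerProductSpace ENNReal

/-- The subdifferential of a function `u` on a set `s` at a point `y`. -/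
def subDiff {V : Type*} [NormedAddCommGroup V] [InnerProductSpace ℝ V]
    (s : Set V) (u : V → ℝ) (y : V) : Set V :=
  {p | ∀ x ∈ s, u y + ⟪p, x - y⟫ ≤ u x}

/-- The Monge–Ampère (Aleksandrov) measure of `u` on `s`, evaluated on a set `A`:
the Lebesgue measure of the image of `A ∩ s` under the subdifferential map. -/
noncomputable def maMeasure {n : ℕ} (s : Set (EuclideanSpace ℝ (Fin n)))
    (u : EuclideanSpace ℝ (Fin n) → ℝ) (A : Set (EuclideanSpace ℝ (Fin n))) : ℝ≥0∞ :=
  volume (⋃ x ∈ A ∩ s, subDiff s u x)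

/-- `u` is a viscosity subsolution of `D_β u ≥ g` on the boundary part `G`. -/
def visSubBdry {n : ℕ} (Ω G : Set (EuclideanSpace ℝ (Fin n)))
    (β : EuclideanSpace ℝ (Fin n) → EuclideanSpace ℝ (Fin n))
    (g u : EuclideanSpace ℝ (Fin n) → ℝ) : Prop :=
  ∀ φ : EuclideanSpace ℝ (Fin n) → ℝ, ContDiffOn ℝ 2 φ (closure Ω) →
    ConvexOn ℝ (closure Ω) φ →
    ∀ x₀ ∈ G, IsLocalMaxOn (fun x => u x - φ x) (closure Ω) x₀ →
      g x₀ ≤ fderivWithin ℝ φ (closure Ω) x₀ (β x₀)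

/-- `v` is a viscosity supersolution of `D_β v ≤ g` on the boundary part `G`. -/
def visSupBdry {n : ℕ} (Ω G : Set (EuclideanSpace ℝ (Fin n)))
    (β : EuclideanSpace ℝ (Fin n) → EuclideanSpace ℝ (Fin n))
    (g v : EuclideanSpace ℝ (Fin n) → ℝ) : Prop :=
  ∀ φ : EuclideanSpace ℝ (Fin n) → ℝ, ContDiffOn ℝ 2 φ (closure Ω) →
    ConvexOn ℝ (closure Ω) φ →
    ∀ x₀ ∈ G, IsLocalMinOn (fun x => v x - φ x) (closure Ω) x₀ →
      fderivWithin ℝ φ (closure Ω) x₀ (β x₀) ≤ g x₀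


lemma sqrt_aux_convex {V : Type*} [NormedAddCommGroup V] [InnerProductSpace ℝ V] (ε : ℝ) :
    ConvexOn ℝ univ (fun v : V => Real.sqrt (‖v‖ ^ 2 + ε ^ 2)) := by
  have h : ∀ v : V, Real.sqrt (‖v‖ ^ 2 + ε ^ 2) = ‖WithLp.toLp 2 (v, ε)‖ := by
    intro v
    rw [WithLp.prod_norm_eq_of_L2]
    simp
  refine ⟨convex_univ, ?_⟩
  intro x _ y _ p q hp hq hpq
  simp only [h]
  have e : WithLp.toLp 2 (p • x + q • y, ε)
      = p • WithLp.toLp 2 (x, ε) + q • WithLp.toLp 2 (y, ε) := by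
    rw [← WithLp.toLp_smul, ← WithLp.toLp_smul, ← WithLp.toLp_add]
    simp only [Prod.smul_mk, Prod.mk_add_mk, smul_eq_mul, ← add_mul, hpq, one_mul]
  rw [e]
  refine (norm_add_le _ _).trans ?_
  rw [norm_smul, norm_smul, Real.norm_of_nonneg hp, Real.norm_of_nonneg hq]
  simp

section
variable {n : ℕ}
local notation "E" => EuclideanSpace ℝ (Fin n)

/-- Coordinate along `b`. -/
noncomputable def sC (b : E) : E →L[ℝ] ℝ := (‖b‖ ^ 2)⁻¹ • innerSL ℝ b
/-- Component perpendicular to `b`. -/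
noncomputable def pC (b : E) : E →L[ℝ] E :=
  ContinuousLinearMap.id ℝ E - (sC b).smulRight b

lemma sC_self (b : E) (hb : b ≠ 0) : sC b b = 1 := by
  have : ‖b‖ ≠ 0 := norm_ne_zero_iff.mpr hb
  simp [sC]
  field_simp

lemma pC_self (b : E) (hb : b ≠ 0) : pC b b = 0 := by
  simp [pC, sC_self b hb]

lemma pC_add (b x : E) : x = sC b x • b + pC b x := by simp [pC]

lemma inner_pC (b x : E) (hb : b ≠ 0) : ⟪pC b x, b⟫ = 0 := by
  have : ‖b‖ ≠ 0 := norm_ne_zero_iff.mpr hb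
  simp [pC, sC, inner_sub_left, inner_smul_left]
  rw [real_inner_comm]; field_simp; simp

lemma inner_pC_pC (b x z : E) (hb : b ≠ 0) : ⟪pC b x, pC b z⟫ = ⟪pC b x, z⟫ := by
  conv_rhs => rw [pC_add b z]
  rw [inner_add_right, inner_smul_right, inner_pC b x hb]; simp

lemma sC_le (b x : E) (hb : b ≠ 0) : |sC b x| * ‖b‖ ≤ ‖x‖ := by
  have h : 0 < ‖b‖ := norm_pos_iff.mpr hb
  have h2 := abs_real_inner_le_norm b x
  have : |sC b x| = |⟪b, x⟫| / ‖b‖ ^ 2 := by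
    simp [sC, abs_mul, abs_inv]; field_simp
  rw [this, div_mul_eq_mul_div, div_le_iff₀ (by positivity)]
  nlinarith

/-- The test function. -/
noncomputable def tF (A k ε : ℝ) (b x₁ : E) (x : E) : ℝ :=
  A * Real.sqrt (‖pC b (x - x₁)‖ ^ 2 + ε ^ 2) - k * sC b (x - x₁)

lemma tF_contDiff (A k ε : ℝ) (hε : 0 < ε) (b x₁ : E) : ContDiff ℝ 2 (tF A k ε b x₁) := by
  have h1 : ContDiff ℝ 2 (fun x : E => pC b (x - x₁)) :=
    (pC b).contDiff.comp (contDiff_id.sub contDiff_const)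
  have h2 : ContDiff ℝ 2 (fun x : E => sC b (x - x₁)) :=
    (sC b).contDiff.comp (contDiff_id.sub contDiff_const)
  unfold tF
  refine (contDiff_const.mul (ContDiff.sqrt ((h1.norm_sq ℝ).add contDiff_const) ?_)).sub
    (contDiff_const.mul h2)
  intro x; positivity

lemma tF_convex (A k ε : ℝ) (hA : 0 ≤ A) (b x₁ : E) : ConvexOn ℝ univ (tF A k ε b x₁) := by
  have h := sqrt_aux_convex (V := E) ε
  refine ⟨convex_univ, ?_⟩
  intro x _ y _ p q hp hq hpq
  have e : p • x + q • y - x₁ = p • (x - x₁) + q • (y - x₁) := by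
    have : x₁ = p • x₁ + q • x₁ := by rw [← add_smul, hpq, one_smul]
    conv_lhs => rw [this]
    simp only [smul_sub]; abel
  have h2 := h.2 (mem_univ (pC b (x - x₁))) (mem_univ (pC b (y - x₁))) hp hq hpq
  simp only [tF, e, map_add, map_smul, smul_eq_mul] at h2 ⊢
  nlinarith [mul_le_mul_of_nonneg_left h2 hA]

lemma tF_fderiv (A k ε : ℝ) (hA : 0 ≤ A) (hk : 0 ≤ k) (hε : 0 < ε) (b x₁ x w : E) (hb : b ≠ 0) :
    fderiv ℝ (tF A k ε b x₁) x w ≤ A * ‖w - b‖ - k + k * (‖w - b‖ / ‖b‖) := by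
  have hb' : 0 < ‖b‖ := norm_pos_iff.mpr hb
  set v := pC b (x - x₁) with hv
  have hpos : 0 < ‖v‖ ^ 2 + ε ^ 2 := by positivity
  have h1 : HasFDerivAt (fun x : E => pC b (x - x₁)) (pC b) x :=
    (pC b).hasFDerivAt.comp x ((hasFDerivAt_id x).sub_const x₁)
  have h2 : HasFDerivAt (fun x : E => sC b (x - x₁)) (sC b) x :=
    (sC b).hasFDerivAt.comp x ((hasFDerivAt_id x).sub_const x₁)
  have h3 := (((h1.norm_sq).add_const (ε ^ 2)).sqrt hpos.ne').const_mul A |>.sub (h2.const_mul k)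
  have h4 : HasFDerivAt (tF A k ε b x₁) _ x := h3
  rw [h4.fderiv]
  have e1 : w = b + (w - b) := by abel
  have e2 : sC b w = 1 + sC b (w - b) := by
    conv_lhs => rw [e1]
    rw [map_add, sC_self b hb]
  have e3 : ⟪v, pC b w⟫ = ⟪v, w - b⟫ := by
    rw [hv, inner_pC_pC _ _ _ hb, inner_sub_right, inner_pC _ _ hb, sub_zero]
  have e4 : -(‖w - b‖ / ‖b‖) ≤ sC b (w - b) := by
    have := sC_le b (w - b) hb
    rw [← le_div_iff₀ hb'] at this
    exact (abs_le.mp this).1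
  have e5 : ⟪v, w - b⟫ / Real.sqrt (‖v‖ ^ 2 + ε ^ 2) ≤ ‖w - b‖ := by
    have hs : 0 < Real.sqrt (‖v‖ ^ 2 + ε ^ 2) := Real.sqrt_pos.mpr hpos
    rw [div_le_iff₀ hs]
    have h6 : ‖v‖ ≤ Real.sqrt (‖v‖ ^ 2 + ε ^ 2) := Real.le_sqrt_of_sq_le (by nlinarith)
    nlinarith [real_inner_le_norm v (w - b), norm_nonneg (w - b)]
  have e6 := mul_le_mul_of_nonneg_left e5 hA
  have e7 := mul_le_mul_of_nonneg_left e4 hk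
  have : ∀ r : ℝ, A * (1 / (2 * Real.sqrt (‖v‖ ^ 2 + ε ^ 2)) * (2 * r))
      = A * (r / Real.sqrt (‖v‖ ^ 2 + ε ^ 2)) := by
    intro r
    have hs : 0 < Real.sqrt (‖v‖ ^ 2 + ε ^ 2) := Real.sqrt_pos.mpr hpos
    field_simp
  have key : (fderiv ℝ (tF A k ε b x₁) x) w
      = A * (⟪v, w - b⟫ / Real.sqrt (‖v‖ ^ 2 + ε ^ 2)) - k * (1 + sC b (w - b)) := by
    rw [h4.fderiv, ← e2, ← e3, ← this]
    simp [hv, inner_sub_left]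
  rw [h4.fderiv] at key
  rw [key]
  linarith

/-- No steep descent along `β` at a boundary point where `u` has bounded upward slope. -/
lemma no_steep (Ω : Set E) (β : E → E) (φ u : E → ℝ) (Φ : ℝ)
    (hO : IsOpen Ω) (hC : Convex ℝ Ω) (hB : Bornology.IsBounded Ω)
    (hβ : ContinuousOn β (frontier Ω)) (hφ : ∀ x ∈ frontier Ω, |φ x| ≤ Φ)
    (hu : ContinuousOn u (closure Ω)) (hcu : ConvexOn ℝ (closure Ω) u)
    (hsub : visSubBdry Ω (frontier Ω) β φ u)
    (x₁ : E) (hx₁ : x₁ ∈ frontier Ω) (hb : β x₁ ≠ 0) (k t ρ B : ℝ) (hk : Φ < k) (ht : 0 < t)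
    (hρ : 0 < ρ) (hB0 : 0 ≤ B) (hball : ball (x₁ + t • β x₁) ρ ⊆ Ω)
    (hlow : ∀ x ∈ ball (x₁ + t • β x₁) ρ, u x ≤ u x₁ - k * t)
    (hup : ∀ x ∈ closure Ω, u x ≤ u x₁ + B * ‖x - x₁‖) : False := by
  set b := β x₁ with hbdef
  have hb' : 0 < ‖b‖ := norm_pos_iff.mpr hb
  have hx₁c : x₁ ∈ closure Ω := frontier_subset_closure hx₁
  have hx₁n : x₁ ∉ Ω := by
    rw [hO.frontier_eq] at hx₁; exact hx₁.2
  have hΦ : 0 ≤ Φ := (abs_nonneg _).trans (hφ x₁ hx₁)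
  obtain ⟨k', hk1, hk2⟩ := exists_between hk
  have hk'0 : 0 < k' := by linarith
  set c := 2 * t / ρ with hc
  have hc0 : 0 < c := by positivity
  set A := B * (‖b‖ * c + 1) + k' * c + 1 with hA
  have hA0 : 0 < A := by positivity
  set r := t * ‖b‖ with hr
  have hr0 : 0 < r := by positivity
  -- strict maximum at the tip
  have strict : ∀ x ∈ closure Ω, ‖x - x₁‖ ≤ r → x ≠ x₁ →
      u x - u x₁ < A * ‖pC b (x - x₁)‖ - k' * sC b (x - x₁) := by
    intro x hx hxr hne
    set s := sC b (x - x₁) with hs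
    set v := pC b (x - x₁) with hv
    have hdec : x - x₁ = s • b + v := pC_add b (x - x₁)
    have hsle : |s| * ‖b‖ ≤ ‖x - x₁‖ := sC_le b _ hb
    by_cases hcase : |s| ≤ c * ‖v‖
    · have hv0 : 0 < ‖v‖ := by
        rw [norm_pos_iff]
        intro h0
        rw [h0] at hcase
        have : s = 0 := by
          have : |s| ≤ 0 := by simpa using hcase
          exact abs_nonpos_iff.mp this
        rw [h0, this] at hdec
        apply hne
        have : x - x₁ = 0 := by simpa using hdec
        exact sub_eq_zero.mp this
      have h1 := hup x hx
      have h2 : ‖x - x₁‖ ≤ |s| * ‖b‖ + ‖v‖ := by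
        rw [hdec]
        refine (norm_add_le _ _).trans ?_
        rw [norm_smul, Real.norm_eq_abs]
      have h3 : |s| * ‖b‖ ≤ c * ‖v‖ * ‖b‖ := mul_le_mul_of_nonneg_right hcase hb'.le
      have h4 : B * ‖x - x₁‖ ≤ B * (c * ‖v‖ * ‖b‖ + ‖v‖) :=
        mul_le_mul_of_nonneg_left (by linarith) hB0
      have h5 : k' * s ≤ k' * (c * ‖v‖) :=
        mul_le_mul_of_nonneg_left ((le_abs_self s).trans hcase) hk'0.le
      have h6 : A * ‖v‖ = B * (c * ‖v‖ * ‖b‖ + ‖v‖) + k' * (c * ‖v‖) + ‖v‖ := by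
        rw [hA]; ring
      linarith
    · push Not at hcase
      have hs0 : s ≠ 0 := by
        intro h0
        rw [h0] at hcase
        have : 0 ≤ c * ‖v‖ := by positivity
        simp at hcase; linarith
      have habs : 0 < |s| := abs_pos.mpr hs0
      -- the point on the sphere of scale t
      set w := x₁ + (t / s) • (x - x₁) with hw
      have hwball : w ∈ ball (x₁ + t • b) ρ := by
        rw [mem_ball, dist_eq_norm]
        have : w - (x₁ + t • b) = (t / s) • v := by
          rw [hw, hdec, smul_add, smul_smul, div_mul_cancel₀ _ hs0]; abel
        rw [this, norm_smul, Real.norm_eq_abs, abs_div, abs_of_pos ht, div_mul_eq_mul_div,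
          div_lt_iff₀ habs]
        have h7 : 2 * t * ‖v‖ < |s| * ρ := by
          rw [hc, div_mul_eq_mul_div, div_lt_iff₀ hρ] at hcase
          exact hcase
        nlinarith [mul_nonneg ht.le (norm_nonneg v)]
      have hwΩ : w ∈ Ω := hball hwball
      rcases lt_or_gt_of_ne hs0 with hneg | hpos
      · exfalso
        -- `x₁` lies between `w` and `x`
        have hcomb := hC.combo_interior_closure_mem_interior
          (a := (-s) / (t - s)) (b := t / (t - s))
          (by rw [hO.interior_eq]; exact hwΩ) hx (div_pos (by linarith) (by linarith))
          (div_nonneg ht.le (by linarith)) (by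
            rw [← add_div, show -s + t = t - s by ring]; exact div_self (by linarith))
        rw [hO.interior_eq] at hcomb
        apply hx₁n
        convert hcomb using 1
        have hts : t - s ≠ 0 := by linarith
        rw [hw, smul_add, smul_smul]
        have e1 : -s / (t - s) * (t / s) = - (t / (t - s)) := by field_simp
        have e2 : -s / (t - s) = 1 - t / (t - s) := by field_simp; ring
        rw [e1, e2]
        module
      · have hst : s ≤ t := by
          have : |s| * ‖b‖ ≤ t * ‖b‖ := hsle.trans hxr
          exact (le_abs_self s).trans (le_of_mul_le_mul_right this hb')
        have h8 := hcu.2 hx₁c (subset_closure hwΩ) 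
          (show (0 : ℝ) ≤ 1 - s / t by rw [sub_nonneg, div_le_one ht]; exact hst)
          (show (0 : ℝ) ≤ s / t by positivity) (by ring)
        have h9 : (1 - s / t) • x₁ + (s / t) • w = x := by
          rw [hw, smul_add, smul_smul]
          have : s / t * (t / s) = 1 := by field_simp
          rw [this]; module
        rw [h9] at h8
        have h10 := hlow w hwball
        simp only [smul_eq_mul] at h8
        have h11 : s / t * u w ≤ s / t * (u x₁ - k * t) :=
          mul_le_mul_of_nonneg_left h10 (by positivity)
        have h12 : s / t * (u x₁ - k * t) = s / t * u x₁ - k * s := by field_simp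
        have h13 : 0 ≤ A * ‖v‖ := by positivity
        nlinarith
  -- choose δ
  obtain ⟨δ, hδ0, hδr, hδ⟩ : ∃ δ, 0 < δ ∧ δ < r ∧ ∀ x ∈ frontier Ω, dist x x₁ < δ →
      (A + k' / ‖b‖) * ‖β x - b‖ < k' - Φ := by
    have hco := (Metric.continuousOn_iff.mp hβ) x₁ hx₁ ((k' - Φ) / (A + k' / ‖b‖))
      (div_pos (by linarith) (by positivity))
    obtain ⟨δ, hδ, h⟩ := hco
    refine ⟨min δ (r / 2), by positivity, (min_le_right _ _).trans_lt (by linarith), ?_⟩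
    intro x hx hd
    have := h x hx (hd.trans_le (min_le_left _ _))
    rw [lt_div_iff₀ (by positivity), dist_eq_norm] at this
    linarith
  have hcomp : IsCompact (closure Ω) := hB.isCompact_closure
  have hN : IsCompact (closure Ω ∩ closedBall x₁ r) := hcomp.inter_right isClosed_closedBall
  -- the gap away from x₁
  obtain ⟨m, hm0, hm⟩ : ∃ m, 0 < m ∧ ∀ x ∈ closure Ω, ‖x - x₁‖ ≤ r → δ ≤ ‖x - x₁‖ →
      u x - u x₁ + m ≤ A * ‖pC b (x - x₁)‖ - k' * sC b (x - x₁) := by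
    have hS : IsCompact ((closure Ω ∩ closedBall x₁ r) ∩ {x | δ ≤ ‖x - x₁‖}) :=
      hN.inter_right (isClosed_le continuous_const (by fun_prop))
    rcases Set.eq_empty_or_nonempty ((closure Ω ∩ closedBall x₁ r) ∩ {x | δ ≤ ‖x - x₁‖})
      with he | hne
    · refine ⟨1, one_pos, ?_⟩
      intro x hx h1 h2
      exfalso
      have : x ∈ ((closure Ω ∩ closedBall x₁ r) ∩ {x | δ ≤ ‖x - x₁‖}) :=
        ⟨⟨hx, by rwa [mem_closedBall, dist_eq_norm]⟩, h2⟩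
      rw [he] at this; exact this
    · have hcont : ContinuousOn
          (fun x => A * ‖pC b (x - x₁)‖ - k' * sC b (x - x₁) - (u x - u x₁))
          ((closure Ω ∩ closedBall x₁ r) ∩ {x | δ ≤ ‖x - x₁‖}) := by
        refine ContinuousOn.sub (Continuous.continuousOn (by fun_prop)) ?_
        exact (hu.mono (fun x hx => hx.1.1)).sub continuousOn_const
      obtain ⟨z, hz, hzm⟩ := hS.exists_isMinOn hne hcont
      refine ⟨A * ‖pC b (z - x₁)‖ - k' * sC b (z - x₁) - (u z - u x₁), ?_, ?_⟩
      · have hz1 : ‖z - x₁‖ ≤ r := by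
          have := hz.1.2; rwa [mem_closedBall, dist_eq_norm] at this
        have := strict z hz.1.1 hz1 (by
          rintro rfl
          have := hz.2
          simp at this; linarith)
        linarith
      · intro x hx h1 h2
        have := hzm (a := x) ⟨⟨hx, by rwa [mem_closedBall, dist_eq_norm]⟩, h2⟩
        simp only [mem_ofPred_eq] at this
        linarith
  set ε := m / (2 * A) with hε
  have hε0 : 0 < ε := by positivity
  have hAε : A * ε < m := by
    rw [hε]; field_simp; linarith
  set ψ := tF A k' ε b x₁ with hψ
  have hψc : ContDiff ℝ 2 ψ := tF_contDiff A k' ε hε0 b x₁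
  have hψ1 : ψ x₁ = A * ε := by
    simp [hψ, tF, Real.sqrt_sq hε0.le]
  have hψge : ∀ x, A * ‖pC b (x - x₁)‖ - k' * sC b (x - x₁) ≤ ψ x := by
    intro x
    have : ‖pC b (x - x₁)‖ ≤ Real.sqrt (‖pC b (x - x₁)‖ ^ 2 + ε ^ 2) :=
      Real.le_sqrt_of_sq_le (by nlinarith)
    have := mul_le_mul_of_nonneg_left this hA0.le
    simp only [hψ, tF]; linarith
  have hcontd : ContinuousOn (fun x => u x - ψ x) (closure Ω ∩ closedBall x₁ r) :=
    (hu.mono inter_subset_left).sub hψc.continuous.continuousOn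
  have hx₁N : x₁ ∈ closure Ω ∩ closedBall x₁ r := ⟨hx₁c, mem_closedBall_self hr0.le⟩
  obtain ⟨z, hz, hzm⟩ := hN.exists_isMaxOn ⟨x₁, hx₁N⟩ hcontd
  -- the set of maximizers
  have hTc : IsCompact ((closure Ω ∩ closedBall x₁ r) ∩ (fun x => u x - ψ x) ⁻¹' (Ici (u z - ψ z))) := by
    refine hN.of_isClosed_subset ?_ inter_subset_left
    exact hcontd.preimage_isClosed_of_isClosed hN.isClosed isClosed_Ici
  obtain ⟨y, hy, hym⟩ := hTc.exists_isMaxOn ⟨z, hz, by simp⟩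
    (f := fun x => sC b x) (sC b).continuous.continuousOn
  have hymax : ∀ x ∈ closure Ω ∩ closedBall x₁ r, u x - ψ x ≤ u y - ψ y := by
    intro x hx
    exact (hzm hx).trans hy.2
  have hyd : ‖y - x₁‖ < δ := by
    by_contra hcon
    push Not at hcon
    have hyr : ‖y - x₁‖ ≤ r := by
      have := hy.1.2; rwa [mem_closedBall, dist_eq_norm] at this
    have h1 := hm y hy.1.1 hyr hcon
    have h2 := hymax x₁ hx₁N
    have h3 := hψge y
    linarith
  have hyF : y ∈ frontier Ω := by
    rw [hO.frontier_eq]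
    refine ⟨hy.1.1, fun hyΩ => ?_⟩
    have hopen : IsOpen (Ω ∩ ball x₁ r) := hO.inter isOpen_ball
    have hymem : y ∈ Ω ∩ ball x₁ r := ⟨hyΩ, by rw [mem_ball, dist_eq_norm]; linarith⟩
    obtain ⟨κ, hκ, hκs⟩ := Metric.isOpen_iff.mp hopen y hymem
    set τ := κ / (2 * ‖b‖) with hτ
    have hτ0 : 0 < τ := by positivity
    have hτb : τ * ‖b‖ < κ := by rw [hτ]; field_simp; linarith
    have hp : y + τ • b ∈ Ω ∩ ball x₁ r := hκs (by
      simp [mem_ball, dist_eq_norm, norm_smul, abs_of_pos hτ0, hτb])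
    have hq : y - τ • b ∈ Ω ∩ ball x₁ r := hκs (by
      simp [mem_ball, dist_eq_norm, norm_smul, abs_of_pos hτ0, hτb])
    have hsub : Ω ∩ ball x₁ r ⊆ closure Ω ∩ closedBall x₁ r :=
      inter_subset_inter subset_closure ball_subset_closedBall
    have h1 := hcu.2 (hsub hp).1 (hsub hq).1 (show (0 : ℝ) ≤ 1 / 2 by norm_num)
      (show (0 : ℝ) ≤ 1 / 2 by norm_num)
      (by norm_num)
    have e1 : (1 / 2 : ℝ) • (y + τ • b) + (1 / 2 : ℝ) • (y - τ • b) = y := by module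
    rw [e1] at h1
    simp only [smul_eq_mul] at h1
    have e2 : ψ (y + τ • b) = ψ y - k' * τ := by
      have : y + τ • b - x₁ = (y - x₁) + τ • b := by abel
      simp only [hψ, tF, this, map_add, map_smul, sC_self b hb, pC_self b hb, smul_zero, add_zero,
        smul_eq_mul]
      ring
    have e3 : ψ (y - τ • b) = ψ y + k' * τ := by
      have : y - τ • b - x₁ = (y - x₁) - τ • b := by abel
      simp only [hψ, tF, this, map_sub (pC b) _ (τ • b), map_sub (sC b) _ (τ • b), map_smul,
        sC_self b hb, pC_self b hb, smul_zero, sub_zero, smul_eq_mul]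
      ring
    have h2 := hymax _ (hsub hq)
    have h3 : u y - ψ y ≤ u (y + τ • b) - ψ (y + τ • b) := by linarith
    have h4 : sC b (y + τ • b) ≤ sC b y :=
      hym (a := y + τ • b) ⟨hsub hp, mem_Ici.mpr (le_trans (mem_Ici.mp hy.2) h3)⟩
    rw [map_add, map_smul, sC_self b hb] at h4
    simp at h4
    linarith
  have hloc : IsLocalMaxOn (fun x => u x - ψ x) (closure Ω) y := by
    have : closedBall x₁ r ∈ nhds y := by
      refine Filter.mem_of_superset (isOpen_ball.mem_nhds ?_) ball_subset_closedBall
      rw [mem_ball, dist_eq_norm]; linarith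
    filter_upwards [self_mem_nhdsWithin, mem_nhdsWithin_of_mem_nhds this] with x h1 h2
    exact hymax x ⟨h1, h2⟩
  have hfin := hsub ψ hψc.contDiffOn
    ((tF_convex A k' ε hA0.le b x₁).subset (subset_univ _) hC.closure) y hyF hloc
  have huniq : UniqueDiffWithinAt ℝ (closure Ω) y := by
    refine uniqueDiffOn_convex hC.closure ?_ y hy.1.1
    exact ⟨x₁ + t • b, interior_mono subset_closure
      (by rw [hO.interior_eq]; exact hball (mem_ball_self hρ))⟩
  have hdiff : DifferentiableAt ℝ ψ y := (hψc.differentiable (by norm_num)) y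
  rw [hdiff.fderivWithin huniq] at hfin
  have hle := tF_fderiv A k' ε hA0.le hk'0.le hε0 b x₁ y (β y) hb
  have h1 := hδ y hyF (by rw [dist_eq_norm]; exact hyd)
  have h2 := (abs_le.mp (hφ y hyF)).1
  have h3 : (A + k' / ‖b‖) * ‖β y - b‖ = A * ‖β y - b‖ + k' * (‖β y - b‖ / ‖b‖) := by ring
  linarith

/-- The one-sided bound along `β`. -/
lemma beta_bound (Ω : Set E) (β : E → E) (φ u : E → ℝ) (Φ : ℝ)
    (hO : IsOpen Ω) (hC : Convex ℝ Ω) (hB : Bornology.IsBounded Ω)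
    (hβ : ContinuousOn β (frontier Ω)) (hβ0 : ∀ x ∈ frontier Ω, β x ≠ 0)
    (hφ : ∀ x ∈ frontier Ω, |φ x| ≤ Φ)
    (hu : ContinuousOn u (closure Ω)) (hcu : ConvexOn ℝ (closure Ω) u)
    (hsub : visSubBdry Ω (frontier Ω) β φ u)
    (x₀ : E) (hx₀ : x₀ ∈ frontier Ω) (t : ℝ) (ht : 0 < t) (hin : x₀ + t • β x₀ ∈ Ω) :
    u x₀ - Φ * t ≤ u (x₀ + t • β x₀) := by
  by_contra hcon
  push Not at hcon
  have hx₀c : x₀ ∈ closure Ω := frontier_subset_closure hx₀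
  set y₀ := x₀ + t • β x₀ with hy₀
  obtain ⟨q, hq1, hq2⟩ := exists_between hcon
  set k := (u x₀ - q) / t with hk
  have hkt : k * t = u x₀ - q := by rw [hk]; field_simp
  have hkΦ : Φ < k := by rw [hk, lt_div_iff₀ ht]; linarith
  have hcomp : IsCompact (closure Ω) := hB.isCompact_closure
  obtain ⟨ρ, hρ, hρs⟩ : ∃ ρ > 0, ball y₀ ρ ⊆ Ω ∩ {x | u x < q} := by
    have h1 : ContinuousAt u y₀ :=
      hu.continuousAt (Filter.mem_of_superset (hO.mem_nhds hin) subset_closure)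
    have h2 : {x | u x < q} ∈ nhds y₀ := h1.eventually (gt_mem_nhds hq1)
    exact Metric.mem_nhds_iff.mp (Filter.inter_mem (hO.mem_nhds hin) h2)
  obtain ⟨xM, hxM, hM⟩ := hcomp.exists_isMaxOn ⟨x₀, hx₀c⟩ hu
  obtain ⟨δ, hδ0, hδ⟩ : ∃ δ > 0, ∀ x ∈ frontier Ω, dist x x₀ < δ →
      ‖(x + t • β x) - y₀‖ < ρ / 2 := by
    have hco : ContinuousOn (fun x => x + t • β x) (frontier Ω) :=
      continuousOn_id.add (hβ.const_smul t)
    obtain ⟨δ, hδ, h⟩ := (Metric.continuousOn_iff.mp hco) x₀ hx₀ (ρ / 2) (by positivity)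
    refine ⟨δ, hδ, fun x hx hd => ?_⟩
    have := h x hx hd
    rwa [dist_eq_norm] at this
  have hM0 : u x₀ ≤ u xM := hM hx₀c
  set B := (u xM - u x₀ + 1) / δ with hBdef
  have hB0 : 0 < B := div_pos (by linarith) hδ0
  have hBδ : B * δ = u xM - u x₀ + 1 := by rw [hBdef]; field_simp
  have hcw : ContinuousOn (fun x => u x - B * ‖x - x₀‖) (closure Ω) :=
    hu.sub (Continuous.continuousOn (by fun_prop))
  obtain ⟨z, hz, hzm⟩ := hcomp.exists_isMaxOn ⟨x₀, hx₀c⟩ hcw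
  have hTc : IsCompact (closure Ω ∩ (fun x => u x - B * ‖x - x₀‖) ⁻¹' (Ici (u z - B * ‖z - x₀‖))) := by
    refine hcomp.of_isClosed_subset ?_ inter_subset_left
    exact hcw.preimage_isClosed_of_isClosed hcomp.isClosed isClosed_Ici
  obtain ⟨x₁, hx₁, hx₁m⟩ := hTc.exists_isMaxOn ⟨z, hz, by simp⟩
    (f := fun x => ‖x - x₀‖) (Continuous.continuousOn (by fun_prop))
  have hmax : ∀ x ∈ closure Ω, u x - B * ‖x - x₀‖ ≤ u x₁ - B * ‖x₁ - x₀‖ := fun x hx =>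
    (hzm hx).trans hx₁.2
  have hx₁F : x₁ ∈ frontier Ω := by
    rw [hO.frontier_eq]
    refine ⟨hx₁.1, fun hin₁ => ?_⟩
    have hne : x₁ ≠ x₀ := by
      rintro rfl
      rw [hO.frontier_eq] at hx₀; exact hx₀.2 hin₁
    have hd : 0 < ‖x₁ - x₀‖ := norm_pos_iff.mpr (sub_ne_zero.mpr hne)
    obtain ⟨κ, hκ, hκs⟩ := Metric.isOpen_iff.mp hO x₁ hin₁
    set τ := κ / (2 * ‖x₁ - x₀‖) with hτ
    have hτ0 : 0 < τ := by positivity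
    have hτb : τ * ‖x₁ - x₀‖ < κ := by rw [hτ]; field_simp; linarith
    have hp : x₁ + τ • (x₁ - x₀) ∈ Ω := hκs (by
      simp [mem_ball, dist_eq_norm, norm_smul, abs_of_pos hτ0, hτb])
    have e0 : x₁ + τ • (x₁ - x₀) - x₀ = (1 + τ) • (x₁ - x₀) := by module
    have hn : ‖x₁ + τ • (x₁ - x₀) - x₀‖ = (1 + τ) * ‖x₁ - x₀‖ := by
      rw [e0, norm_smul, Real.norm_of_nonneg (by positivity)]
    have h1 := hcu.2 hx₀c (subset_closure hp) 
      (show (0 : ℝ) ≤ τ / (1 + τ) by positivity) (show (0 : ℝ) ≤ 1 / (1 + τ) by positivity) (by field_simp; ring)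
    have e1 : (τ / (1 + τ)) • x₀ + (1 / (1 + τ)) • (x₁ + τ • (x₁ - x₀)) = x₁ := by
      have : x₁ + τ • (x₁ - x₀) = x₀ + (1 + τ) • (x₁ - x₀) := by module
      rw [this, smul_add, smul_smul, ← add_assoc, ← add_smul]
      have h1 : τ / (1 + τ) + 1 / (1 + τ) = 1 := by field_simp; ring
      have h2 : 1 / (1 + τ) * (1 + τ) = 1 := by field_simp
      rw [h1, h2]; module
    rw [e1] at h1
    simp only [smul_eq_mul] at h1
    have h2 : (1 + τ) * u x₁ ≤ τ * u x₀ + u (x₁ + τ • (x₁ - x₀)) := by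
      have := mul_le_mul_of_nonneg_left h1 (show 0 ≤ 1 + τ by positivity)
      refine this.trans (le_of_eq ?_)
      field_simp
    have h3 := hmax x₀ hx₀c
    simp only [sub_self, norm_zero, mul_zero, sub_zero] at h3
    have h4 : u x₁ - B * ‖x₁ - x₀‖ ≤ u (x₁ + τ • (x₁ - x₀)) - B * ‖x₁ + τ • (x₁ - x₀) - x₀‖ := by
      rw [hn]
      nlinarith [mul_le_mul_of_nonneg_left h3 hτ0.le]
    have h5 : ‖x₁ + τ • (x₁ - x₀) - x₀‖ ≤ ‖x₁ - x₀‖ :=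
      hx₁m (a := x₁ + τ • (x₁ - x₀))
        ⟨subset_closure hp, mem_Ici.mpr (le_trans (mem_Ici.mp hx₁.2) h4)⟩
    rw [hn] at h5
    nlinarith
  have h3 := hmax x₀ hx₀c
  simp only [sub_self, norm_zero, mul_zero, sub_zero] at h3
  have hclose : dist x₁ x₀ < δ := by
    rw [dist_eq_norm]
    have h4 : u x₁ ≤ u xM := hM hx₁.1
    by_contra hcc
    push Not at hcc
    have := mul_le_mul_of_nonneg_left hcc hB0.le
    linarith
  have hge : u x₀ ≤ u x₁ := by
    have : 0 ≤ B * ‖x₁ - x₀‖ := by positivity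
    linarith
  have hbs : ball (x₁ + t • β x₁) (ρ / 2) ⊆ ball y₀ ρ := by
    intro x hx
    rw [mem_ball] at hx ⊢
    have := hδ x₁ hx₁F hclose
    rw [← dist_eq_norm] at this
    linarith [dist_triangle x (x₁ + t • β x₁) y₀]
  refine no_steep Ω β φ u Φ hO hC hB hβ hφ hu hcu hsub x₁ hx₁F (hβ0 x₁ hx₁F) k t (ρ / 2) B hkΦ ht
    (by positivity) hB0.le (fun x hx => (hρs (hbs hx)).1) ?_ ?_
  · intro x hx
    have : u x < q := (hρs (hbs hx)).2
    linarith
  · intro x hx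
    have h4 := hmax x hx
    have h5 : ‖x - x₀‖ ≤ ‖x - x₁‖ + ‖x₁ - x₀‖ := norm_sub_le_norm_sub_add_norm_sub _ _ _
    nlinarith [mul_le_mul_of_nonneg_left h5 hB0.le]


/-- Slope bound at a boundary point. -/
lemma slope_bound (Ω : Set E) (β : E → E) (u : E → ℝ) (Φ a η m : ℝ) (ha : 0 < a) (hη : 0 < η)
    (hcu : ConvexOn ℝ (closure Ω) u)
    (x₀ : E) (hin : ∀ t ∈ Ioo (0 : ℝ) a, ∀ z ∈ ball (β x₀) η, x₀ + t • z ∈ Ω)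
    (hbb : ∀ t : ℝ, 0 < t → x₀ + t • β x₀ ∈ Ω → u x₀ - Φ * t ≤ u (x₀ + t • β x₀))
    (hm : ∀ t ∈ Ioc (0 : ℝ) (a / 2), ∀ z ∈ ball (β x₀) η, u (x₀ + t • z) ≤ u x₀ + m * t)
    (y : E) (hy : y ∈ closure Ω) :
    u x₀ - u y ≤ 2 / η * (Φ + m) * ‖y - x₀‖ := by
  by_cases hyx : y = x₀
  · simp [hyx]
  have hd : 0 < ‖y - x₀‖ := norm_pos_iff.mpr (sub_ne_zero.mpr hyx)
  set d := ‖y - x₀‖ with hddef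
  -- weight σ on y, and time t with σ d = t η / 2
  set σ := min (1 / 2) (a * η / (8 * d)) with hσ
  have hσ0 : 0 < σ := by positivity
  have hσ1 : σ ≤ 1 / 2 := min_le_left _ _
  have hσ2 : σ * (8 * d) ≤ a * η := by
    rw [← le_div_iff₀ (by positivity)]; exact min_le_right _ _
  set t := 2 * σ * d / η with ht
  have ht0 : 0 < t := by positivity
  have htη : t * η = 2 * σ * d := by rw [ht]; field_simp
  have hta : t ≤ a / 4 := by
    rw [ht, div_le_iff₀ hη]; linarith
  have h1σ : 0 < 1 - σ := by linarith
  set τ := t / (1 - σ) with hτ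
  have hτ0 : 0 < τ := by positivity
  have hτa : τ ≤ a / 2 := by
    rw [hτ, div_le_iff₀ h1σ]; nlinarith
  set z := β x₀ - (σ / t) • (y - x₀) with hz
  have hzb : z ∈ ball (β x₀) η := by
    rw [mem_ball, dist_eq_norm]
    have : z - β x₀ = -((σ / t) • (y - x₀)) := by rw [hz]; abel
    rw [this, norm_neg, norm_smul, Real.norm_of_nonneg (by positivity), div_mul_eq_mul_div,
      div_lt_iff₀ ht0, ← hddef]
    nlinarith
  have hw : x₀ + τ • z ∈ Ω := hin τ ⟨hτ0, by linarith⟩ z hzb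
  have hcomb : σ • y + (1 - σ) • (x₀ + τ • z) = x₀ + t • β x₀ := by
    have e1 : (1 - σ) * τ = t := by rw [hτ]; field_simp
    have e2 : t * (σ / t) = σ := by field_simp
    rw [smul_add, smul_smul, e1, hz, smul_sub, smul_smul, e2]
    module
  have h1 := hcu.2 hy (subset_closure hw) hσ0.le h1σ.le (by ring)
  rw [hcomb] at h1
  simp only [smul_eq_mul] at h1
  have h2 := hbb t ht0 (hin t ⟨ht0, by linarith⟩ _ (mem_ball_self hη))
  have h3 := mul_le_mul_of_nonneg_left (hm τ ⟨hτ0, hτa⟩ z hzb) h1σ.le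
  have h4 : (1 - σ) * (u x₀ + m * τ) = (1 - σ) * u x₀ + m * t := by
    rw [hτ]; field_simp
  have h5 : σ * (u x₀ - u y) ≤ (Φ + m) * t := by nlinarith
  have h6 : (Φ + m) * t = σ * (2 / η * (Φ + m) * d) := by rw [ht]; field_simp
  rw [h6] at h5
  exact le_of_mul_le_mul_left h5 hσ0

end

/-- Theorem 3.8: a continuous convex solution of `det D²u = f` (with
`λ ≤ f ≤ Λ`) and `D_β u = φ` on `∂Ω` in the viscosity sense satisfies
`sup u − inf u ≤ C(a,η) diam(Ω) ‖φ‖_∞` and the global Lipschitz estimate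
`‖u‖_{Lip} ≤ C(a,η)(1 + diam(Ω)) ‖φ‖_∞`. -/
theorem stmt14 (n : ℕ) (a η : ℝ) (ha : 0 < a) (hη : 0 < η) :
    ∃ C : ℝ, 0 < C ∧
      ∀ (Ω : Set (EuclideanSpace ℝ (Fin n)))
        (β : EuclideanSpace ℝ (Fin n) → EuclideanSpace ℝ (Fin n))
        (φ f u : EuclideanSpace ℝ (Fin n) → ℝ) (lam Lam Φ : ℝ) (K : NNReal),
        IsOpen Ω → Convex ℝ Ω → Bornology.IsBounded Ω → Ω.Nonempty →
        LipschitzOnWith K β (frontier Ω) →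
        (∀ x ∈ frontier Ω, a ≤ ‖β x‖ ∧ ‖β x‖ ≤ a⁻¹) →
        (∀ x ∈ frontier Ω, ∀ t ∈ Ioo (0 : ℝ) a, ∀ z ∈ ball (β x) η, x + t • z ∈ Ω) →
        ContinuousOn φ (frontier Ω) → (∀ x ∈ frontier Ω, |φ x| ≤ Φ) →
        0 < lam → (∀ x ∈ Ω, lam ≤ f x ∧ f x ≤ Lam) →
        ContinuousOn u (closure Ω) → ConvexOn ℝ (closure Ω) u →
        (∀ A : Set (EuclideanSpace ℝ (Fin n)), MeasurableSet A →
          maMeasure Ω u A = ∫⁻ x in A ∩ Ω, ENNReal.ofReal (f x)) →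
        visSubBdry Ω (frontier Ω) β φ u → visSupBdry Ω (frontier Ω) β φ u →
        ((∀ x ∈ Ω, ∀ y ∈ Ω, u x - u y ≤ C * Metric.diam Ω * Φ) ∧
          LipschitzOnWith (Real.toNNReal (C * (1 + Metric.diam Ω) * Φ)) u
            (closure Ω)) := by
  refine ⟨2 / η + 8 / (a * η ^ 2), by positivity, ?_⟩
  intro Ω β φ f u lam Lam Φ K hO hC hB hne hLip hnorm hin hφc hφ hlam hf hu hcu hma hsub hsup
  rcases subsingleton_or_nontrivial (EuclideanSpace ℝ (Fin n)) with hss | hnt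
  · constructor
    · intro x _ y _
      have hxy : x = y := Subsingleton.elim _ _
      have hd0 : Metric.diam Ω = 0 := Metric.diam_subsingleton Set.subsingleton_of_subsingleton
      rw [hxy, hd0]; simp
    · intro x _ y _
      have hxy : x = y := Subsingleton.elim _ _
      rw [hxy]; simp
  have hcomp : IsCompact (closure Ω) := hB.isCompact_closure
  have hnuniv : Ω ≠ univ := by
    rintro rfl
    exact NormedSpace.unbounded_univ ℝ (EuclideanSpace ℝ (Fin n)) hB
  obtain ⟨xf, hxf⟩ : (frontier Ω).Nonempty := nonempty_frontier_iff.mpr ⟨hne, hnuniv⟩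
  have hΦ : 0 ≤ Φ := (abs_nonneg _).trans (hφ xf hxf)
  set D := Metric.diam Ω with hD
  have hD0 : 0 ≤ D := Metric.diam_nonneg
  have hdist : ∀ x ∈ closure Ω, ∀ y ∈ closure Ω, ‖x - y‖ ≤ D := by
    intro x hx y hy
    rw [← dist_eq_norm, hD, ← Metric.diam_closure]
    exact Metric.dist_le_diam_of_mem hB.closure hx hy
  have hbb : ∀ x₀ ∈ frontier Ω, ∀ t : ℝ, 0 < t → x₀ + t • β x₀ ∈ Ω →
      u x₀ - Φ * t ≤ u (x₀ + t • β x₀) := by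
    intro x₀ hx₀ t ht hmem
    refine beta_bound Ω β φ u Φ hO hC hB hLip.continuousOn ?_ hφ hu hcu hsub x₀ hx₀ t ht hmem
    intro x hx h0
    have := (hnorm x hx).1
    rw [h0, norm_zero] at this
    linarith
  -- every interior point lies on a chord from any point to the frontier
  have hexit : ∀ x ∈ Ω, ∀ y ∈ closure Ω, x ≠ y → ∃ x₀ ∈ frontier Ω, ∃ θ ∈ Icc (0 : ℝ) 1,
      x = (1 - θ) • y + θ • x₀ := by
    intro x hx y hy hxy
    have hd : 0 < ‖x - y‖ := norm_pos_iff.mpr (sub_ne_zero.mpr hxy)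
    set T := 1 + (D + 1) / ‖x - y‖ with hT
    have hT1 : 1 ≤ T := by
      have : 0 ≤ (D + 1) / ‖x - y‖ := by positivity
      linarith
    have hpre : IsPreconnected ((fun s : ℝ => y + s • (x - y)) '' Icc 1 T) :=
      isPreconnected_Icc.image _ (Continuous.continuousOn (by fun_prop))
    obtain ⟨s, hs, hp⟩ : ∃ s ∈ Icc 1 T, y + s • (x - y) ∈ frontier Ω := by
      by_contra hno
      push Not at hno
      obtain ⟨p, _, hp1, hp2⟩ := hpre Ω (closure Ω)ᶜ hO isClosed_closure.isOpen_compl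
        (by
          rintro _ ⟨s, hs, rfl⟩
          have h1 := hno s hs
          rw [hO.frontier_eq] at h1
          by_cases h2 : y + s • (x - y) ∈ Ω
          · exact Or.inl h2
          · exact Or.inr (fun h3 => h1 ⟨h3, h2⟩))
        ⟨x, ⟨1, ⟨le_rfl, hT1⟩, by simp⟩, hx⟩
        ⟨y + T • (x - y), ⟨T, ⟨hT1, le_rfl⟩, rfl⟩, by
          intro hmem
          have h1 := hdist _ hmem y hy
          rw [add_sub_cancel_left, norm_smul, Real.norm_of_nonneg (by linarith), hT, add_mul,
            div_mul_cancel₀ _ hd.ne'] at h1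
          linarith⟩
      exact hp2 (subset_closure hp1)
    have hs0 : 0 < s := by linarith [hs.1]
    refine ⟨_, hp, 1 / s, ⟨by positivity, by rw [div_le_one hs0]; exact hs.1⟩, ?_⟩
    rw [smul_add, smul_smul, one_div_mul_cancel hs0.ne']
    module
  have hchord : ∀ L : ℝ, (∀ x₀ ∈ frontier Ω, ∀ y ∈ closure Ω, u x₀ - u y ≤ L * ‖y - x₀‖) →
      ∀ x ∈ closure Ω, ∀ y ∈ closure Ω, u x - u y ≤ L * ‖x - y‖ := by
    intro L hL x hx y hy
    by_cases hxΩ : x ∈ Ω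
    · by_cases hxy : x = y
      · simp [hxy]
      obtain ⟨x₀, hx₀, θ, hθ, hxe⟩ := hexit x hxΩ y hy hxy
      have h1 := hcu.2 hy (frontier_subset_closure hx₀) (sub_nonneg.mpr hθ.2) hθ.1 (by ring)
      rw [← hxe] at h1
      simp only [smul_eq_mul] at h1
      have h2 := mul_le_mul_of_nonneg_left (hL x₀ hx₀ y hy) hθ.1
      have h3 : x - y = θ • (x₀ - y) := by rw [hxe]; module
      rw [h3, norm_smul, Real.norm_of_nonneg hθ.1, norm_sub_rev x₀ y]
      nlinarith
    · rw [norm_sub_rev]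
      exact hL x (by rw [hO.frontier_eq]; exact ⟨hx, hxΩ⟩) y hy
  -- oscillation
  have hosc : ∀ x ∈ closure Ω, ∀ y ∈ closure Ω, u x - u y ≤ 2 / η * Φ * D := by
    obtain ⟨xm, hxm, hmax⟩ := hcomp.exists_isMaxOn hne.closure hu
    obtain ⟨xM, hxMf, hxM⟩ : ∃ xM ∈ frontier Ω, ∀ x ∈ closure Ω, u x ≤ u xM := by
      by_cases hxmΩ : xm ∈ Ω
      · have hfc := frontier_subset_closure hxf
        have hnef : xm ≠ xf := by
          rintro rfl
          rw [hO.frontier_eq] at hxf; exact hxf.2 hxmΩ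
        obtain ⟨x₀, hx₀, θ, hθ, hxe⟩ := hexit xm hxmΩ xf hfc hnef
        refine ⟨x₀, hx₀, fun x hx => ?_⟩
        have h1 := hcu.2 hfc (frontier_subset_closure hx₀) (sub_nonneg.mpr hθ.2) hθ.1 (by ring)
        rw [← hxe] at h1
        simp only [smul_eq_mul] at h1
        have h2 : u xf ≤ u xm := hmax hfc
        have h3 : u x ≤ u xm := hmax hx
        have hθ0 : 0 < θ := by
          rcases hθ.1.lt_or_eq with h | h
          · exact h
          · exfalso; apply hnef; rw [hxe, ← h]; simp
        have h4 := mul_le_mul_of_nonneg_left h2 (sub_nonneg.mpr hθ.2)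
        have h5 : θ * u xm ≤ θ * u x₀ := by linarith
        linarith [le_of_mul_le_mul_left h5 hθ0]
      · exact ⟨xm, by rw [hO.frontier_eq]; exact ⟨hxm, hxmΩ⟩, fun x hx => hmax hx⟩
    intro x hx y hy
    have h1 := slope_bound Ω β u Φ a η 0 ha hη hcu xM (hin xM hxMf) (hbb xM hxMf)
      (fun t ht z hz => by
        rw [zero_mul, add_zero]
        exact hxM _ (subset_closure (hin xM hxMf t ⟨ht.1, by linarith [ht.2]⟩ z hz))) y hy
    rw [add_zero] at h1
    have h2 := mul_le_mul_of_nonneg_left (hdist y hy xM (frontier_subset_closure hxMf))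
      (show 0 ≤ 2 / η * Φ by positivity)
    linarith [hxM x hx]
  constructor
  · intro x hx y hy
    have h1 := hosc x (subset_closure hx) y (subset_closure hy)
    have h2 : 0 ≤ 8 / (a * η ^ 2) * (D * Φ) := by positivity
    nlinarith
  set O := 2 / η * Φ * D with hOd
  have hO0 : 0 ≤ O := by positivity
  have hL := hchord (2 / η * (Φ + 2 * O / a)) (by
    intro x₀ hx₀ y hy
    refine slope_bound Ω β u Φ a η (2 * O / a) ha hη hcu x₀ (hin x₀ hx₀) (hbb x₀ hx₀) ?_ y hy
    intro t ht z hz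
    have hx₀c := frontier_subset_closure hx₀
    have hw : x₀ + (a / 2) • z ∈ Ω := hin x₀ hx₀ (a / 2) ⟨by positivity, by linarith⟩ z hz
    have hq1 : 2 * t / a ≤ 1 := by rw [div_le_one ha]; linarith [ht.2]
    have ht0 := ht.1
    have hq0 : 0 ≤ 2 * t / a := by positivity
    have h1 := hcu.2 hx₀c (subset_closure hw) (sub_nonneg.mpr hq1) hq0 (by ring)
    have e1 : (1 - 2 * t / a) • x₀ + (2 * t / a) • (x₀ + (a / 2) • z) = x₀ + t • z := by
      rw [smul_add, smul_smul]
      have : 2 * t / a * (a / 2) = t := by field_simp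
      rw [this]; module
    rw [e1] at h1
    simp only [smul_eq_mul] at h1
    have h2 := mul_le_mul_of_nonneg_left (hosc _ (subset_closure hw) x₀ hx₀c) hq0
    have h3 : 2 * t / a * O = 2 * O / a * t := by ring
    linarith)
  have hfinal : 2 / η * (Φ + 2 * O / a) ≤ (2 / η + 8 / (a * η ^ 2)) * (1 + D) * Φ := by
    have e : 2 / η * (Φ + 2 * O / a) = 2 / η * Φ + 8 / (a * η ^ 2) * (D * Φ) := by
      rw [hOd]; field_simp; ring
    have h1 : 0 ≤ 8 / (a * η ^ 2) * Φ := by positivity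
    have h2 : 0 ≤ 2 / η * (D * Φ) := by positivity
    rw [e]; linarith
  refine LipschitzOnWith.of_le_add_mul _ ?_
  intro x hx y hy
  rw [Real.coe_toNNReal _ (by positivity), dist_eq_norm]
  have h1 := hL x hx y hy
  have h2 := mul_le_mul_of_nonneg_right hfinal (norm_nonneg (x - y))
  linarith
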